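/- Fix a real 2×2 matrix B = (B_{ij}). For l ∈ ℕ and smooth functions f, g : ℝ² → ℝ define C_l(f,g) := (1/l!) · Σ over all indices i₁,…,i_l, j₁,…,j_l ∈ {1,2} of B_{i₁ j₁}···B_{i_l j_l} · (∂_{i₁}···∂_{i_l} f) · (∂_{j₁}···∂_{j_l} g), where ∂₁, ∂₂ denote the partial derivatives with respect to the two coordinates. Then for every l ∈ ℕ and all smooth f, g, h : ℝ² → ℝ one has Σ_{m+n=l} C_m(C_n(f,g), h) = Σ_{m+n=l} C_m(f, C_n(g,h)). Consequently, the product on formal power series over C^∞(ℝ²) defined by f * g = Σ_l C_l(f,g) λ^l is associative; in particular, taking B antisymmetric yields the associativity of the Moyal product. -/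

import Mathlib

/-- The partial derivative `∂ᵢ` of a function on `ℝ²`. -/
noncomputable def pdF (i : Fin 2) (f : (Fin 2 → ℝ) → ℝ) : (Fin 2 → ℝ) → ℝ :=
  fun x => fderiv ℝ f x (Pi.single i 1)

/-- Iterated partial derivatives `∂_{i₁} ⋯ ∂_{i_l}` indexed by a list of coordinates. -/
noncomputable def pdIter : List (Fin 2) → ((Fin 2 → ℝ) → ℝ) → ((Fin 2 → ℝ) → ℝ)
  | [], f => f
  | i :: is, f => pdF i (pdIter is f)

/-- The bidifferential operator
`C_l(f,g) = (1/l!) Σ_{i₁,…,i_l, j₁,…,j_l} B_{i₁j₁}⋯B_{i_lj_l} (∂_{i₁}⋯∂_{i_l} f)(∂_{j₁}⋯∂_{j_l} g)`. -/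
noncomputable def Cop (B : Matrix (Fin 2) (Fin 2) ℝ) (l : ℕ)
    (f g : (Fin 2 → ℝ) → ℝ) : (Fin 2 → ℝ) → ℝ :=
  fun x => (1 / l.factorial : ℝ) *
    ∑ iv : Fin l → Fin 2, ∑ jv : Fin l → Fin 2,
      (∏ k : Fin l, B (iv k) (jv k)) * pdIter (List.ofFn iv) f x * pdIter (List.ofFn jv) g x

open Finset

section Abstract

variable {K A ι : Type*} [Field K] [CommRing A] [Algebra K A] [Fintype ι]

/-- The `l`-th coefficient of the exponential star product attached to coefficients `B` and a family
of derivations `D` of a commutative algebra. -/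
noncomputable def starCoeff (B : ι → ι → K) (D : ι → Derivation K A A) :
    ℕ → A →ₗ[K] A →ₗ[K] A
  | 0 => LinearMap.mul K A
  | l + 1 => ((l : K) + 1)⁻¹ • ∑ i, ∑ j, B i j •
      (starCoeff B D l).compl₁₂ (D i : A →ₗ[K] A) (D j : A →ₗ[K] A)

theorem starCoeff_zero (B : ι → ι → K) (D : ι → Derivation K A A) (f g : A) :
    starCoeff B D 0 f g = f * g := rfl

theorem starCoeff_succ (B : ι → ι → K) (D : ι → Derivation K A A) (l : ℕ) (f g : A) :
    starCoeff B D (l + 1) f g =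
      ((l : K) + 1)⁻¹ • ∑ i, ∑ j, B i j • starCoeff B D l (D i f) (D j g) := by
  simp [starCoeff, LinearMap.sum_apply]

theorem smul_starCoeff_succ [CharZero K] (B : ι → ι → K) (D : ι → Derivation K A A) (l : ℕ)
    (f g : A) :
    ((l : K) + 1) • starCoeff B D (l + 1) f g =
      ∑ i, ∑ j, B i j • starCoeff B D l (D i f) (D j g) := by
  rw [starCoeff_succ, smul_inv_smul₀ (Nat.cast_add_one_ne_zero l)]

theorem derivation_starCoeff (B : ι → ι → K) (D : ι → Derivation K A A)
    (hD : ∀ i j f, D i (D j f) = D j (D i f)) (k : ι) (l : ℕ) (f g : A) :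
    D k (starCoeff B D l f g) = starCoeff B D l (D k f) g + starCoeff B D l f (D k g) := by
  induction l generalizing f g with
  | zero => simp [starCoeff_zero, mul_comm, add_comm]
  | succ l ih =>
    have comm_f (i : ι) : D i (D k f) = D k (D i f) := hD i k f
    have comm_g (j : ι) : D j (D k g) = D k (D j g) := hD j k g
    simp only [starCoeff_succ, Derivation.map_smul, map_sum, ih, smul_add, sum_add_distrib,
      comm_f, comm_g]

theorem smul_sum_antidiagonal_succ {K A : Type*} [Semiring K] [AddCommMonoid A] [Module K A]
    (l : ℕ) (F : ℕ → ℕ → A) :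
    ((l : K) + 1) • ∑ p ∈ antidiagonal (l + 1), F p.1 p.2 =
      ∑ p ∈ antidiagonal l, ((p.2 : K) + 1) • F p.1 (p.2 + 1) +
        ∑ p ∈ antidiagonal l, ((p.1 : K) + 1) • F (p.1 + 1) p.2 := by
  have split : ((l : K) + 1) • ∑ p ∈ antidiagonal (l + 1), F p.1 p.2 =
      ∑ p ∈ antidiagonal (l + 1), (p.2 : K) • F p.1 p.2 +
        ∑ p ∈ antidiagonal (l + 1), (p.1 : K) • F p.1 p.2 := by
    rw [smul_sum, ← sum_add_distrib]
    refine sum_congr rfl fun p hp => ?_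
    rw [← add_smul, ← Nat.cast_add, add_comm p.2, mem_antidiagonal.1 hp, Nat.cast_succ]
  rw [split, Nat.sum_antidiagonal_succ', Nat.sum_antidiagonal_succ]
  simp

theorem sum_antidiagonal_sum_smul {K A ι : Type*} [Semiring K] [AddCommMonoid A] [Module K A]
    [Fintype ι] (B : ι → ι → K) (l : ℕ) (X : ℕ × ℕ → ι → ι → A) :
    ∑ p ∈ antidiagonal l, ∑ i, ∑ j, B i j • X p i j =
      ∑ i, ∑ j, B i j • ∑ p ∈ antidiagonal l, X p i j := by
  rw [sum_comm]
  refine sum_congr rfl fun i _ => ?_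
  rw [sum_comm]
  simp only [smul_sum]

theorem smul_sum_starCoeff_left [CharZero K] (B : ι → ι → K) (D : ι → Derivation K A A)
    (hD : ∀ i j f, D i (D j f) = D j (D i f)) (l : ℕ) (f g h : A) :
    ((l : K) + 1) • ∑ p ∈ antidiagonal (l + 1), starCoeff B D p.1 (starCoeff B D p.2 f g) h =
      ∑ i, ∑ j, B i j •
        (∑ p ∈ antidiagonal l, starCoeff B D p.1 (starCoeff B D p.2 (D i f) (D j g)) h +
          ∑ p ∈ antidiagonal l, starCoeff B D p.1 (starCoeff B D p.2 (D i f) g) (D j h) +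
          ∑ p ∈ antidiagonal l, starCoeff B D p.1 (starCoeff B D p.2 f (D i g)) (D j h)) := by
  have inner (m n : ℕ) : ((n : K) + 1) • starCoeff B D m (starCoeff B D (n + 1) f g) h =
      ∑ i, ∑ j, B i j • starCoeff B D m (starCoeff B D n (D i f) (D j g)) h := by
    rw [← LinearMap.smul_apply, ← map_smul, smul_starCoeff_succ]
    simp [LinearMap.sum_apply]
  rw [smul_sum_antidiagonal_succ l fun m n => starCoeff B D m (starCoeff B D n f g) h]
  simp only [inner, smul_starCoeff_succ, derivation_starCoeff B D hD, map_add,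
    LinearMap.add_apply]
  rw [sum_antidiagonal_sum_smul, sum_antidiagonal_sum_smul]
  simp only [smul_add, sum_add_distrib, add_assoc]

theorem smul_sum_starCoeff_right [CharZero K] (B : ι → ι → K) (D : ι → Derivation K A A)
    (hD : ∀ i j f, D i (D j f) = D j (D i f)) (l : ℕ) (f g h : A) :
    ((l : K) + 1) • ∑ p ∈ antidiagonal (l + 1), starCoeff B D p.1 f (starCoeff B D p.2 g h) =
      ∑ i, ∑ j, B i j •
        (∑ p ∈ antidiagonal l, starCoeff B D p.1 (D i f) (starCoeff B D p.2 (D j g) h) +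
          ∑ p ∈ antidiagonal l, starCoeff B D p.1 (D i f) (starCoeff B D p.2 g (D j h)) +
          ∑ p ∈ antidiagonal l, starCoeff B D p.1 f (starCoeff B D p.2 (D i g) (D j h))) := by
  have inner (m n : ℕ) : ((n : K) + 1) • starCoeff B D m f (starCoeff B D (n + 1) g h) =
      ∑ i, ∑ j, B i j • starCoeff B D m f (starCoeff B D n (D i g) (D j h)) := by
    rw [← map_smul, smul_starCoeff_succ]
    simp
  rw [smul_sum_antidiagonal_succ l fun m n => starCoeff B D m f (starCoeff B D n g h)]
  simp only [inner, smul_starCoeff_succ, derivation_starCoeff B D hD, map_add]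
  rw [sum_antidiagonal_sum_smul, sum_antidiagonal_sum_smul]
  simp only [smul_add, sum_add_distrib]
  abel

theorem starCoeff_assoc [CharZero K] (B : ι → ι → K) (D : ι → Derivation K A A)
    (hD : ∀ i j f, D i (D j f) = D j (D i f)) (l : ℕ) (f g h : A) :
    ∑ p ∈ antidiagonal l, starCoeff B D p.1 (starCoeff B D p.2 f g) h =
      ∑ p ∈ antidiagonal l, starCoeff B D p.1 f (starCoeff B D p.2 g h) := by
  induction l generalizing f g h with
  | zero => simp [starCoeff_zero, mul_assoc]
  | succ l ih =>
    refine smul_right_injective A (Nat.cast_add_one_ne_zero (R := K) l) ?_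
    simp only [smul_sum_starCoeff_left B D hD, smul_sum_starCoeff_right B D hD, ih]

end Abstract

/-- The algebra of smooth functions on `ℝ²`. -/
def smoothFunctions : Subalgebra ℝ ((Fin 2 → ℝ) → ℝ) where
  carrier := {f | ContDiff ℝ (⊤ : ℕ∞) f}
  mul_mem' := fun {f g} (hf : ContDiff ℝ (⊤ : ℕ∞) f) (hg : ContDiff ℝ (⊤ : ℕ∞) g) => hf.mul hg
  add_mem' := fun {f g} (hf : ContDiff ℝ (⊤ : ℕ∞) f) (hg : ContDiff ℝ (⊤ : ℕ∞) g) => hf.add hg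
  algebraMap_mem' c := (contDiff_const : ContDiff ℝ (⊤ : ℕ∞) fun _ => c)

theorem differentiable_coe (f : smoothFunctions) : Differentiable ℝ (f : (Fin 2 → ℝ) → ℝ) :=
  ContDiff.differentiable (n := (⊤ : ℕ∞)) f.2 (by simp)

theorem contDiff_pdF (i : Fin 2) {f : (Fin 2 → ℝ) → ℝ} (hf : ContDiff ℝ (⊤ : ℕ∞) f) :
    ContDiff ℝ (⊤ : ℕ∞) (pdF i f) :=
  (hf.fderiv_right (m := (⊤ : ℕ∞)) (by simp)).clm_apply contDiff_const

theorem pdF_comm (i j : Fin 2) {f : (Fin 2 → ℝ) → ℝ} (hf : ContDiff ℝ (⊤ : ℕ∞) f) :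
    pdF i (pdF j f) = pdF j (pdF i f) := by
  have hd : Differentiable ℝ (fderiv ℝ f) :=
    (hf.fderiv_right (m := (⊤ : ℕ∞)) (by simp)).differentiable (by simp)
  have second (i j : Fin 2) (x : Fin 2 → ℝ) :
      pdF i (pdF j f) x = fderiv ℝ (fderiv ℝ f) x (Pi.single i 1) (Pi.single j 1) := by
    change fderiv ℝ (fun y => fderiv ℝ f y (Pi.single j 1)) x _ = _
    rw [fderiv_clm_apply (hd x) (differentiableAt_const _)]
    simp
  funext x
  rw [second, second]
  exact hf.contDiffAt.isSymmSndFDerivAt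
    (by simpa using WithTop.coe_le_coe.2 (le_top : (2 : ℕ∞) ≤ ⊤)) _ _

/-- The partial derivative `∂ᵢ` as a derivation of the algebra of smooth functions. -/
noncomputable def pdDerivation (i : Fin 2) : Derivation ℝ smoothFunctions smoothFunctions :=
  Derivation.mk'
    { toFun := fun f => ⟨pdF i f, contDiff_pdF i f.2⟩
      map_add' := fun f g => Subtype.ext <| funext fun x => by
        have hf := differentiable_coe f x
        have hg := differentiable_coe g x
        simp [pdF, fderiv_add hf hg]
      map_smul' := fun c f => Subtype.ext <| funext fun x => by
        have hf := differentiable_coe f x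
        simp [pdF, fderiv_const_smul hf c] }
    fun f g => Subtype.ext <| funext fun x => by
      have hf := differentiable_coe f x
      have hg := differentiable_coe g x
      simp [pdF, fderiv_mul hf hg]

theorem coe_pdDerivation (i : Fin 2) (f : smoothFunctions) :
    (pdDerivation i f : (Fin 2 → ℝ) → ℝ) = pdF i f := rfl

theorem pdIter_concat (L : List (Fin 2)) (i : Fin 2) (f : (Fin 2 → ℝ) → ℝ) :
    pdIter (L.concat i) f = pdIter L (pdF i f) := by
  induction L with
  | nil => rfl
  | cons j L ih => simp only [List.concat_cons, pdIter, ih]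

theorem Cop_succ (B : Matrix (Fin 2) (Fin 2) ℝ) (l : ℕ) (f g : (Fin 2 → ℝ) → ℝ) :
    Cop B (l + 1) f g =
      ((l : ℝ) + 1)⁻¹ • ∑ i, ∑ j, B i j • Cop B l (pdF i f) (pdF j g) := by
  have sum_snoc (F : (Fin (l + 1) → Fin 2) → ℝ) :
      ∑ v, F v = ∑ i, ∑ v : Fin l → Fin 2, F (Fin.snoc v i) := by
    rw [← (Fin.snocEquiv fun _ : Fin (l + 1) => Fin 2).sum_comp, Fintype.sum_prod_type]
    rfl
  funext x
  simp only [Cop, sum_snoc, List.ofFn_succ', Fin.snoc_castSucc, Fin.snoc_last, pdIter_concat,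
    Fin.prod_univ_castSucc, Pi.smul_apply, Finset.sum_apply, smul_eq_mul, mul_sum]
  refine sum_congr rfl fun i _ => ?_
  rw [sum_comm]
  refine sum_congr rfl fun j _ => sum_congr rfl fun v _ => sum_congr rfl fun w _ => ?_
  rw [Nat.factorial_succ]
  push_cast
  field_simp

theorem coe_starCoeff_pdDerivation (B : Matrix (Fin 2) (Fin 2) ℝ) (l : ℕ)
    (f g : smoothFunctions) :
    (starCoeff (fun i j => B i j) pdDerivation l f g : (Fin 2 → ℝ) → ℝ) = Cop B l f g := by
  induction l generalizing f g with
  | zero =>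
    funext x
    simp [starCoeff_zero, Cop, pdIter]
  | succ l ih =>
    rw [starCoeff_succ, Cop_succ]
    simp [ih, coe_pdDerivation]

/-- The bidifferential operators `C_l` built from a fixed matrix `B`
satisfy the order-by-order Cauchy-product associativity identities
`Σ_{m+n=l} C_m(C_n(f,g),h) = Σ_{m+n=l} C_m(f,C_n(g,h))` for smooth `f, g, h`;
these are exactly the associativity identities of the star product
`f * g = Σ_l C_l(f,g) λ^l` (in particular, for antisymmetric `B`, of the Moyal product). -/
theorem star_product_associativity (B : Matrix (Fin 2) (Fin 2) ℝ) (l : ℕ)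
    (f g h : (Fin 2 → ℝ) → ℝ)
    (hf : ContDiff ℝ (⊤ : ℕ∞) f) (hg : ContDiff ℝ (⊤ : ℕ∞) g) (hh : ContDiff ℝ (⊤ : ℕ∞) h) :
    ∑ p ∈ Finset.HasAntidiagonal.antidiagonal l, Cop B p.1 (Cop B p.2 f g) h
      = ∑ p ∈ Finset.HasAntidiagonal.antidiagonal l, Cop B p.1 f (Cop B p.2 g h) := by
  have key := congrArg Subtype.val <| starCoeff_assoc (fun i j => B i j) pdDerivation
    (fun i j u => Subtype.ext (pdF_comm i j u.2)) l
    (⟨f, hf⟩ : smoothFunctions) ⟨g, hg⟩ ⟨h, hh⟩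
  simpa [coe_starCoeff_pdDerivation] using key
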